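/- arXiv:2511.22140 — 3 statements merged into one kernel-verified Lean document; each statement's English description precedes it below -/
import Mathlib

section
/- Let D = (V,E) be a finite r-rooted digraph and let B be a maximal element of G(D). If B is a flame, then B is large. -/
/-- A digraph on vertex type `V` with edge type `E` (parallel edges allowed, no loops). -/
structure MultiDigraph (V : Type*) (E : Type*) where
  tail : E → V
  head : E → V
  no_loops : ∀ e, tail e ≠ head e

namespace MultiDigraph

variable {V E : Type*}

/-- `p` is a (finite) directed path from `s` to `t` in the spanning subdigraph `D(L)`,
identified with its list of edges (consecutive edges are incident, visited vertices
are pairwise distinct). -/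
def IsPathIn (D : MultiDigraph V E) (L : Set E) (s t : V) (p : List E) : Prop :=
  ∃ hne : p ≠ [],
    D.tail (p.head hne) = s ∧
    D.head (p.getLast hne) = t ∧
    p.Chain' (fun e f => D.head e = D.tail f) ∧
    (s :: p.map D.head).Nodup ∧
    ∀ e ∈ p, e ∈ L

/-- `δ_{D(L)}(v)`: the set of ingoing edges of `v` lying in `L`. -/
def delta (D : MultiDigraph V E) (L : Set E) (v : V) : Set E :=
  {e | e ∈ L ∧ D.head e = v}

/-- `δ_{D(L)}(X)`: the set of edges of `D(L)` entering the vertex set `X`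
(tail outside `X`, head inside `X`). -/
def edgesInto (D : MultiDigraph V E) (L : Set E) (X : Set V) : Set E :=
  {e | e ∈ L ∧ D.tail e ∉ X ∧ D.head e ∈ X}

/-- `I ∈ 𝒢_{D(L)}(v)`: `I` is a set of ingoing edges of `v` in `D(L)` for which
there is a set of pairwise edge-disjoint `r`–`v` paths of `D(L)` covering `I`. -/
def MemGv (D : MultiDigraph V E) (L : Set E) (r v : V) (I : Set E) : Prop :=
  I ⊆ D.delta L v ∧
  ∃ Ps : Set (List E),
    (∀ p ∈ Ps, D.IsPathIn L r v p) ∧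
    Ps.Pairwise (fun p q => p.Disjoint q) ∧
    ∀ e ∈ I, ∃ p ∈ Ps, e ∈ p

/-- `L' ∈ 𝒢(D(L))`: `L'` is a union `⋃_{v ≠ r} I_v` with `I_v ∈ 𝒢_{D(L)}(v)`;
equivalently, every edge of `L'` has head distinct from `r` and for each `v ≠ r`
the set of ingoing edges of `v` in `L'` belongs to `𝒢_{D(L)}(v)`. -/
def MemG (D : MultiDigraph V E) (L : Set E) (r : V) (L' : Set E) : Prop :=
  L' ⊆ L ∧ (∀ e ∈ L', D.head e ≠ r) ∧
    ∀ v, v ≠ r → D.MemGv L r v (D.delta L' v)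

/-- `F` is a flame: `F ∈ 𝒢(D(F))`. -/
def IsFlame (D : MultiDigraph V E) (r : V) (F : Set E) : Prop :=
  D.MemG F r F

/-- `C` is a transversal of the set `Ps` of paths: `C` consists of exactly one
edge from each path in `Ps`. -/
def IsTransversal (Ps : Set (List E)) (C : Set E) : Prop :=
  (∀ p ∈ Ps, ∃! e, e ∈ C ∧ e ∈ p) ∧ ∀ e ∈ C, ∃ p ∈ Ps, e ∈ p

/-- `C` is an `s`–`t` cut in `D(L)`: every `s`–`t` path of `D(L)` meets `C`. -/
def IsCut (D : MultiDigraph V E) (L : Set E) (s t : V) (C : Set E) : Prop :=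
  ∀ p, D.IsPathIn L s t p → ∃ e ∈ p, e ∈ C

/-- `L` is large at `v`: `D(L)` admits a set `Ps` of pairwise edge-disjoint
`r`–`v` paths together with a transversal of `Ps` that is an `r`–`v` cut in `D`. -/
def LargeAt (D : MultiDigraph V E) (r v : V) (L : Set E) : Prop :=
  ∃ (Ps : Set (List E)) (C : Set E),
    (∀ p ∈ Ps, D.IsPathIn L r v p) ∧
    Ps.Pairwise (fun p q => p.Disjoint q) ∧
    IsTransversal Ps C ∧
    D.IsCut Set.univ r v C

/-- `L` is large: it is large at every `v ≠ r`. -/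
def Large (D : MultiDigraph V E) (r : V) (L : Set E) : Prop :=
  ∀ v, v ≠ r → D.LargeAt r v L

/-- `D` contains a directed cycle. -/
def HasCycle (D : MultiDigraph V E) : Prop :=
  ∃ (p : List E) (hne : p ≠ []),
    p.Chain' (fun e f => D.head e = D.tail f) ∧
    D.head (p.getLast hne) = D.tail (p.head hne) ∧
    (p.map D.head).Nodup

/-- `D` contains a backward-infinite path: edges `…, f 2, f 1, f 0` (with `f 0` the
last edge, so the path has a final vertex `D.head (f 0)` but no first vertex); the
visited vertices `D.head (f n)` are pairwise distinct. -/
def HasBackwardInfinitePath (D : MultiDigraph V E) : Prop :=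
  ∃ f : ℕ → E,
    (∀ n, D.tail (f n) = D.head (f (n + 1))) ∧
    Function.Injective (fun n => D.head (f n))

/-- `X ⊆ V \ {r}` is `v`-linked in `D(L)`: `v ∈ X` and there is a family
`{P e : e ∈ δ_{D(L)}(X)}` of pairwise edge-disjoint paths of `D(L)`, where `P e`
has `e` as its initial edge and `v` as its terminal vertex. -/
def VLinked (D : MultiDigraph V E) (L : Set E) (r v : V) (X : Set V) : Prop :=
  r ∉ X ∧ v ∈ X ∧
  ∃ P : E → List E,
    (∀ e ∈ D.edgesInto L X, D.IsPathIn L (D.tail e) v (P e) ∧ (P e).head? = some e) ∧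
    (D.edgesInto L X).Pairwise (fun e f => (P e).Disjoint (P f))

/-- `p` is an `r`–`X` path in `D(L)`: a path starting at `r` meeting `X` exactly
in its last vertex. -/
def IsRXPathIn (D : MultiDigraph V E) (L : Set E) (r : V) (X : Set V) (p : List E) : Prop :=
  ∃ hne : p ≠ [],
    D.tail (p.head hne) = r ∧
    D.head (p.getLast hne) ∈ X ∧
    (∀ e ∈ p.dropLast, D.head e ∉ X) ∧
    p.Chain' (fun e f => D.head e = D.tail f) ∧
    (r :: p.map D.head).Nodup ∧
    ∀ e ∈ p, e ∈ L

/-- `X` is fillable in `D(L)`: there is a set `Ps` of pairwise edge-disjoint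
`r`–`X` paths in `D(L)` whose set of terminal edges is exactly `δ_{D(L)}(X)`. -/
def Fillable (D : MultiDigraph V E) (L : Set E) (r : V) (X : Set V) : Prop :=
  ∃ Ps : Set (List E),
    (∀ p ∈ Ps, D.IsRXPathIn L r X p) ∧
    Ps.Pairwise (fun p q => p.Disjoint q) ∧
    {e | ∃ p ∈ Ps, p.getLast? = some e} = D.edgesInto L X

end MultiDigraph

namespace MultiDigraph

variable {V E : Type*}

/-- A recursive form of `IsPathIn` which also allows the trivial path. -/
def IsSimplePath (D : MultiDigraph V E) (L : Set E) : V → V → List E → Prop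
  | s, t, [] => s = t
  | s, t, e :: p =>
      e ∈ L ∧ D.tail e = s ∧ s ∉ (e :: p).map D.head ∧ IsSimplePath D L (D.head e) t p

theorem isPathIn_iff_isSimplePath (D : MultiDigraph V E) (L : Set E) (s t : V) (p : List E) :
    D.IsPathIn L s t p ↔ p ≠ [] ∧ D.IsSimplePath L s t p := by
  induction p generalizing s with
  | nil => simp [IsPathIn]
  | cons e p ih =>
    cases p with
    | nil =>
      simp only [IsPathIn, IsSimplePath]
      simp
      tauto
    | cons f q =>
      have h := ih (D.head e)
      have key : D.IsPathIn L s t (e :: f :: q) ↔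
          e ∈ L ∧ D.tail e = s ∧ s ∉ (e :: f :: q).map D.head ∧
            D.IsPathIn L (D.head e) t (f :: q) := by
        simp only [IsPathIn, List.head_cons, ne_eq, reduceCtorEq, not_false_eq_true,
          exists_true_left, List.getLast_cons, List.map_cons,
          List.nodup_cons, List.forall_mem_cons]
        constructor
        · rintro ⟨h1, h2, h34, h5, h6, h7⟩
          obtain ⟨h3, h4⟩ := List.isChain_cons_cons.1 h34
          exact ⟨h6, h1, h5.1, h3.symm, h2, h4, h5.2, h7⟩
        · rintro ⟨h6, h1, h5, h3, h2, h4, h5', h7⟩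
          exact ⟨h1, h2, List.isChain_cons_cons.2 ⟨h3.symm, h4⟩, ⟨h5, h5'⟩, h6, h7⟩
      rw [key, h]
      simp [IsSimplePath]

theorem IsPathIn.mono {D : MultiDigraph V E} {L L' : Set E} (h : L ⊆ L') {s t : V} {p : List E}
    (hp : D.IsPathIn L s t p) : D.IsPathIn L' s t p := by
  obtain ⟨h0, h1, h2, h3, h4, h5⟩ := hp
  exact ⟨h0, h1, h2, h3, h4, fun e he => h (h5 e he)⟩

theorem IsPathIn.nodup {D : MultiDigraph V E} {L : Set E} {s t : V} {p : List E}
    (hp : D.IsPathIn L s t p) : p.Nodup := by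
  obtain ⟨-, -, -, -, h, -⟩ := hp
  exact (List.nodup_cons.1 h).2.of_map

theorem IsSimplePath.exists_of_mem {D : MultiDigraph V E} {L : Set E} {s t x : V} {p : List E}
    (hp : D.IsSimplePath L s t p) (hx : x ∈ s :: p.map D.head) :
    ∃ q, D.IsSimplePath L x t q := by
  induction p generalizing s with
  | nil =>
    simp only [List.map_nil, List.mem_singleton] at hx
    exact ⟨[], by rw [hx]; exact hp⟩
  | cons e p ih =>
    rcases List.mem_cons.1 hx with rfl | hx
    · exact ⟨e :: p, hp⟩
    · exact ih hp.2.2.2 hx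

/-- `t` can be reached from `s` by a single edge of `D(L)`. -/
def Step (D : MultiDigraph V E) (L : Set E) (s t : V) : Prop :=
  ∃ e ∈ L, D.tail e = s ∧ D.head e = t

theorem exists_isSimplePath {D : MultiDigraph V E} {L : Set E} {s t : V}
    (h : Relation.ReflTransGen (D.Step L) s t) : ∃ p, D.IsSimplePath L s t p := by
  induction h using Relation.ReflTransGen.head_induction_on with
  | refl => exact ⟨[], rfl⟩
  | head h _ ih =>
    obtain ⟨e, he, rfl, rfl⟩ := h
    obtain ⟨p, hp⟩ := ih
    by_cases hs : D.tail e ∈ D.head e :: p.map D.head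
    · exact hp.exists_of_mem hs
    · exact ⟨e :: p, he, rfl, hs, hp⟩

theorem IsSimplePath.exists_leaving {D : MultiDigraph V E} {L : Set E} {s t : V} {p : List E}
    (hp : D.IsSimplePath L s t p) {X : Set V} (hs : s ∈ X) (ht : t ∉ X) :
    ∃ e ∈ p, D.tail e ∈ X ∧ D.head e ∉ X := by
  induction p generalizing s with
  | nil => exact absurd (hp ▸ hs) ht
  | cons e p ih =>
    obtain ⟨-, rfl, -, hp⟩ := hp
    by_cases h : D.head e ∈ X
    · obtain ⟨f, hf, hf'⟩ := ih hp h
      exact ⟨f, List.mem_cons_of_mem _ hf, hf'⟩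
    · exact ⟨e, List.mem_cons_self, hs, h⟩

theorem IsSimplePath.tail_notMem {D : MultiDigraph V E} {L : Set E} {s t : V} {p : List E}
    (hp : D.IsSimplePath L s t p) {X : Set V} (hs : s ∉ X)
    (hL : ∀ e ∈ L, D.head e ∈ X → D.tail e ∈ X) :
    ∀ e ∈ p, D.tail e ∉ X := by
  induction p generalizing s with
  | nil => simp
  | cons e p ih =>
    obtain ⟨he, rfl, -, hp⟩ := hp
    rw [List.forall_mem_cons]
    exact ⟨hs, ih hp fun h => hs (hL e he h)⟩

theorem IsSimplePath.leaving_unique {D : MultiDigraph V E} {L : Set E} {s t : V} {p : List E}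
    (hp : D.IsSimplePath L s t p) {X : Set V}
    (hL : ∀ e ∈ L, D.head e ∈ X → D.tail e ∈ X) {e f : E}
    (he : e ∈ p) (hf : f ∈ p) (he' : D.tail e ∈ X ∧ D.head e ∉ X)
    (hf' : D.tail f ∈ X ∧ D.head f ∉ X) : e = f := by
  induction p generalizing s with
  | nil => simp at he
  | cons g p ih =>
    obtain ⟨-, -, -, hp⟩ := hp
    rcases List.mem_cons.1 he with rfl | hep <;> rcases List.mem_cons.1 hf with rfl | hfp
    · rfl
    · exact absurd hf'.1 (hp.tail_notMem he'.2 hL f hfp)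
    · exact absurd he'.1 (hp.tail_notMem hf'.2 hL e hep)
    · exact ih hp hep hfp

theorem IsSimplePath.tail_ne {D : MultiDigraph V E} {L : Set E} {s t : V} {p : List E}
    (hp : D.IsSimplePath L s t p) : ∀ e ∈ p, D.tail e ≠ t := by
  induction p generalizing s with
  | nil => simp
  | cons e p ih =>
    obtain ⟨he, rfl, hnot, hp⟩ := hp
    rw [List.forall_mem_cons]
    refine ⟨?_, ih hp⟩
    rintro rfl
    apply hnot
    clear ih hnot he
    generalize D.tail e = t at hp
    induction p generalizing e with
    | nil => exact List.mem_singleton.2 (show D.head e = t from hp).symm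
    | cons z p ih => exact List.mem_cons_of_mem _ (ih z hp.2.2.2)

open Classical in
/-- The contribution of the edge `e` to the excess at `u`: `1` if `e` leaves `u` and `-1` if
it enters `u`. -/
noncomputable def incidence (D : MultiDigraph V E) (u : V) (e : E) : ℤ :=
  (if D.tail e = u then 1 else 0) - (if D.head e = u then 1 else 0)

open Classical in
theorem IsSimplePath.sum_incidence {D : MultiDigraph V E} {L : Set E} {s t : V} {p : List E}
    (hp : D.IsSimplePath L s t p) (u : V) :
    (p.map (D.incidence u)).sum = (if s = u then 1 else 0) - (if t = u then 1 else 0) := by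
  induction p generalizing s with
  | nil => rw [show s = t from hp]; simp
  | cons e p ih =>
    obtain ⟨-, rfl, -, hp⟩ := hp
    rw [List.map_cons, List.sum_cons, ih hp, incidence]
    ring

open Classical in
theorem IsPathIn.sum_incidence {D : MultiDigraph V E} {L : Set E} {s t u : V} {p : List E}
    (hp : D.IsPathIn L s t p) (hs : u ≠ s) (ht : u ≠ t) :
    ∑ e ∈ p.toFinset, D.incidence u e = 0 := by
  rw [List.sum_toFinset _ hp.nodup,
    ((D.isPathIn_iff_isSimplePath _ _ _ _).1 hp).2.sum_incidence u]
  simp [hs.symm, ht.symm]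

open Classical in
theorem exists_isPathIn_of_conservation [Fintype V] (D : MultiDigraph V E) {r v : V}
    (hv : v ≠ r) (F : Finset E)
    (hcons : ∀ u, u ≠ r → u ≠ v → ∑ e ∈ F, D.incidence u e = 0)
    (hout : ∀ e ∈ F, D.tail e ≠ v) {e : E} (he : e ∈ F) (hev : D.head e = v) :
    ∃ p, D.IsPathIn F r v p := by
  have hreach : Relation.ReflTransGen (D.Step F) r v := by
    by_contra hr
    set X : Finset V := Finset.univ.filter fun u => Relation.ReflTransGen (D.Step F) u v with hX
    have h1 : ∑ u ∈ X, ∑ f ∈ F, D.incidence u f = ∑ f ∈ F, D.incidence v f := by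
      refine Finset.sum_eq_single v ?_ ?_
      · intro u hu huv
        refine hcons u ?_ huv
        rintro rfl
        exact hr (by simpa [hX] using hu)
      · intro h
        exact absurd (by simp [hX, Relation.ReflTransGen.refl]) h
    have h2 : ∑ f ∈ F, D.incidence v f < 0 := by
      refine Finset.sum_neg' (fun f hf => ?_) ⟨e, he, ?_⟩
      · rw [incidence, if_neg (hout f hf)]
        split_ifs <;> norm_num
      · rw [incidence, if_neg (hout e he), if_pos hev]
        norm_num
    have h3 : 0 ≤ ∑ u ∈ X, ∑ f ∈ F, D.incidence u f := by
      rw [Finset.sum_comm]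
      refine Finset.sum_nonneg fun f hf => ?_
      simp only [incidence, Finset.sum_sub_distrib, Finset.sum_ite_eq]
      by_cases hh : D.head f ∈ X
      · have : D.tail f ∈ X := by
          simp only [hX, Finset.mem_filter, Finset.mem_univ, true_and] at hh ⊢
          exact Relation.ReflTransGen.head ⟨f, hf, rfl, rfl⟩ hh
        simp [hh, this]
      · rw [if_neg hh]
        split_ifs <;> norm_num
    omega
  obtain ⟨p, hp⟩ := exists_isSimplePath hreach
  refine ⟨p, (D.isPathIn_iff_isSimplePath _ _ _ _).2 ⟨?_, hp⟩⟩
  rintro rfl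
  exact hv (show r = v from hp).symm

open Classical in
theorem exists_paths_of_conservation [Fintype V] (D : MultiDigraph V E) {r v : V}
    (hv : v ≠ r) (F : Finset E)
    (hcons : ∀ u, u ≠ r → u ≠ v → ∑ e ∈ F, D.incidence u e = 0)
    (hout : ∀ e ∈ F, D.tail e ≠ v) :
    ∃ Ps : Set (List E), (∀ p ∈ Ps, D.IsPathIn F r v p) ∧
      Ps.Pairwise (fun p q => p.Disjoint q) ∧
      ∀ e ∈ F, D.head e = v → ∃ p ∈ Ps, e ∈ p := by
  induction F using Finset.strongInduction with
  | H F ih =>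
    by_cases h : ∃ e ∈ F, D.head e = v
    · obtain ⟨e, he, hev⟩ := h
      obtain ⟨p, hp⟩ := D.exists_isPathIn_of_conservation hv F hcons hout he hev
      have hpF : p.toFinset ⊆ F := by
        intro f hf
        exact hp.2.2.2.2.2 f (List.mem_toFinset.1 hf)
      have hne : p.toFinset.Nonempty := by
        obtain ⟨hne, -⟩ := hp
        exact List.toFinset_nonempty_iff p |>.2 hne
      have hcons' : ∀ u, u ≠ r → u ≠ v → ∑ e ∈ F \ p.toFinset, D.incidence u e = 0 := by
        intro u hur huv
        have := Finset.sum_sdiff (f := D.incidence u) hpF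
        rw [hp.sum_incidence hur huv, hcons u hur huv] at this
        simpa using this
      obtain ⟨Ps, h1, h2, h3⟩ := ih (F \ p.toFinset) (Finset.sdiff_ssubset hpF hne) hcons'
        fun e he => hout e (Finset.mem_sdiff.1 he).1
      have hdis : ∀ q ∈ Ps, p.Disjoint q := by
        intro q hq f hfp hfq
        have := (h1 q hq).2.2.2.2.2 f hfq
        simp [hfp] at this
      refine ⟨insert p Ps, ?_, ?_, ?_⟩
      · rintro q (rfl | hq)
        · exact hp
        · exact (h1 q hq).mono (by simp)
      · exact (Set.pairwise_insert).2 ⟨h2, fun q hq _ => ⟨hdis q hq, (hdis q hq).symm⟩⟩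
      · intro f hf hfv
        by_cases hfp : f ∈ p
        · exact ⟨p, Set.mem_insert _ _, hfp⟩
        · obtain ⟨q, hq, hfq⟩ := h3 f (by simp [hf, hfp]) hfv
          exact ⟨q, Set.mem_insert_of_mem _ hq, hfq⟩
    · push Not at h
      exact ⟨∅, by simp, by simp, fun e he hev => absurd hev (h e he)⟩

/-- The digraph with edges `(e, true)` for `e` traversed forwards and `(e, false)` for `e`
traversed backwards. -/
def bidirected (D : MultiDigraph V E) : MultiDigraph V (E × Bool) where
  tail x := if x.2 then D.tail x.1 else D.head x.1
  head x := if x.2 then D.head x.1 else D.tail x.1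
  no_loops := by
    rintro ⟨e, _ | _⟩
    · simpa using (D.no_loops e).symm
    · simpa using D.no_loops e

/-- The edges of the residual digraph of `F`: unused edges forwards, used edges backwards. -/
def residual (F : Set E) : Set (E × Bool) :=
  {x | if x.2 then x.1 ∉ F else x.1 ∈ F}

open Classical in
theorem exists_augmentation (D : MultiDigraph V E) (F : Finset E) {v : V}
    (hout : ∀ e ∈ F, D.tail e ≠ v) {a : V} {p : List (E × Bool)}
    (hp : D.bidirected.IsSimplePath (residual F) a v p) :
    ∃ F' : Finset E,
      (∀ u, ∑ e ∈ F', D.incidence u e =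
        ∑ e ∈ F, D.incidence u e + ((if a = u then 1 else 0) - (if v = u then 1 else 0))) ∧
      (∀ u, u ∉ a :: p.map D.bidirected.head →
        ∀ e, D.tail e = u ∨ D.head e = u → (e ∈ F' ↔ e ∈ F)) ∧
      (∀ e ∈ F, D.head e = v → e ∈ F') ∧
      (∀ e ∈ F', D.tail e ≠ v) ∧
      (p ≠ [] → ∃ e ∈ F', D.head e = v ∧ e ∉ F) := by
  induction p generalizing a with
  | nil =>
    obtain rfl : a = v := hp
    exact ⟨F, by simp, by simp, fun e he _ => he, hout, by simp⟩
  | cons x p ih =>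
    obtain ⟨e, d⟩ := x
    have hav := hp.tail_ne _ List.mem_cons_self
    obtain ⟨hx, rfl, hnot, hp⟩ := hp
    obtain ⟨F₁, h1, h2, h3, h4, h5⟩ := ih hp
    have hinc := h2 _ hnot e
    have hsub : ∀ u, u ∉ D.bidirected.tail (e, d) :: ((e, d) :: p).map D.bidirected.head →
        ∀ f, D.tail f = u ∨ D.head f = u → f ≠ e ∧ (f ∈ F₁ ↔ f ∈ F) := by
      intro u hu f hf
      simp only [List.mem_cons, not_or, List.map_cons] at hu
      refine ⟨?_, h2 u (by simp [hu]) f hf⟩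
      rintro rfl
      cases d <;> simp [bidirected] at hu <;> grind
    cases d with
    | true =>
      simp only [bidirected, residual, if_true, Set.mem_ofPred_eq, Finset.mem_coe] at *
      have heF₁ : e ∉ F₁ := fun h => hx ((hinc (by simp)).1 h)
      refine ⟨insert e F₁, ?_, ?_, ?_, ?_, ?_⟩
      · intro u
        rw [Finset.sum_insert heF₁, h1, incidence]
        ring
      · intro u hu f hf
        have := hsub u hu f hf
        simp [this]
      · intro f hf hfv
        exact Finset.mem_insert_of_mem (h3 f hf hfv)
      · intro f hf
        rcases Finset.mem_insert.1 hf with rfl | hf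
        · exact hav
        · exact h4 f hf
      · intro _
        by_cases hpn : p = []
        · subst hpn
          exact ⟨e, Finset.mem_insert_self _ _, hp, hx⟩
        · obtain ⟨f, hf, hfv, hfF⟩ := h5 hpn
          exact ⟨f, Finset.mem_insert_of_mem hf, hfv, hfF⟩
    | false =>
      simp only [bidirected, residual, Set.mem_ofPred_eq, Finset.mem_coe,
        Bool.false_eq_true, if_false] at *
      have heF₁ : e ∈ F₁ := (hinc (by simp)).2 hx
      refine ⟨F₁.erase e, ?_, ?_, ?_, ?_, ?_⟩
      · intro u
        have := Finset.sum_erase_add F₁ (D.incidence u) heF₁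
        rw [h1, incidence] at this
        linarith
      · intro u hu f hf
        have := hsub u hu f hf
        simp [this]
      · intro f hf hfv
        refine Finset.mem_erase.2 ⟨?_, h3 f hf hfv⟩
        rintro rfl
        exact hav hfv
      · intro f hf
        exact h4 f (Finset.mem_of_mem_erase hf)
      · intro _
        by_cases hpn : p = []
        · subst hpn
          exact absurd hp (hout e hx)
        · obtain ⟨f, hf, hfv, hfF⟩ := h5 hpn
          refine ⟨f, Finset.mem_erase.2 ⟨?_, hf⟩, hfv, hfF⟩
          rintro rfl
          exact hav hfv

open Classical in
/-- A system of edge-disjoint `r`–`v` paths either has a transversal which is a cut, or can be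
augmented to a system whose terminal edges properly include those of the original one. -/
theorem exists_transversal_cut_or_augmentation [Fintype V] [Fintype E] (D : MultiDigraph V E)
    {r v : V} (hv : v ≠ r) (Ps : Set (List E)) {L : Set E} (hPs : ∀ p ∈ Ps, D.IsPathIn L r v p)
    (hdis : Ps.Pairwise fun p q => p.Disjoint q) :
    (∃ C, IsTransversal Ps C ∧ D.IsCut Set.univ r v C) ∨
    ∃ Qs : Set (List E), (∀ q ∈ Qs, D.IsPathIn Set.univ r v q) ∧
      Qs.Pairwise (fun p q => p.Disjoint q) ∧
      (∀ p ∈ Ps, ∀ e ∈ p, D.head e = v → ∃ q ∈ Qs, e ∈ q) ∧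
      ∃ e, D.head e = v ∧ (∀ p ∈ Ps, e ∉ p) ∧ ∃ q ∈ Qs, e ∈ q := by
  have hfin : Ps.Finite := by
    refine (List.finite_length_le E (Fintype.card E)).subset ?_
    exact fun p hp => (hPs p hp).nodup.length_le_card
  set F : Finset E := hfin.toFinset.biUnion List.toFinset with hF
  have hmemF : ∀ e, e ∈ F ↔ ∃ p ∈ Ps, e ∈ p := by simp [hF]
  have hsimple : ∀ p ∈ Ps, D.IsSimplePath F r v p := by
    intro p hp
    refine ((D.isPathIn_iff_isSimplePath _ _ _ _).1 ?_).2
    obtain ⟨h0, h1, h2, h3, h4, -⟩ := hPs p hp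
    exact ⟨h0, h1, h2, h3, h4, fun e he => (hmemF e).2 ⟨p, hp, he⟩⟩
  have hout : ∀ e ∈ F, D.tail e ≠ v := by
    intro e he
    obtain ⟨p, hp, hep⟩ := (hmemF e).1 he
    exact (hsimple p hp).tail_ne e hep
  have hcons : ∀ u, u ≠ r → u ≠ v → ∑ e ∈ F, D.incidence u e = 0 := by
    intro u hur huv
    rw [hF, Finset.sum_biUnion]
    · exact Finset.sum_eq_zero fun p hp => (hPs p (by simpa using hp)).sum_incidence hur huv
    · intro p hp q hq hpq
      exact List.disjoint_toFinset_iff_disjoint.2 (hdis (by simpa using hp) (by simpa using hq) hpq)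
  by_cases hreach : Relation.ReflTransGen (D.bidirected.Step (residual F)) r v
  · right
    obtain ⟨p, hp⟩ := exists_isSimplePath hreach
    have hpn : p ≠ [] := by
      rintro rfl
      exact hv (show r = v from hp).symm
    obtain ⟨F', h1, -, h3, h4, h5⟩ := D.exists_augmentation F hout hp
    obtain ⟨e, heF', hev, heF⟩ := h5 hpn
    obtain ⟨Qs, hQ1, hQ2, hQ3⟩ := D.exists_paths_of_conservation hv F' (by
      intro u hur huv
      rw [h1, hcons u hur huv]
      simp [hur.symm, huv.symm]) h4
    refine ⟨Qs, fun q hq => (hQ1 q hq).mono (Set.subset_univ _), hQ2, ?_, e, hev, ?_, ?_⟩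
    · intro p hp f hf hfv
      exact hQ3 f (h3 f ((hmemF f).2 ⟨p, hp, hf⟩) hfv) hfv
    · intro p hp hep
      exact heF ((hmemF e).2 ⟨p, hp, hep⟩)
    · exact hQ3 e heF' hev
  · left
    set X : Set V := {u | Relation.ReflTransGen (D.bidirected.Step (residual F)) r u} with hX
    have hrX : r ∈ X := Relation.ReflTransGen.refl
    have hback : ∀ e ∈ (F : Set E), D.head e ∈ X → D.tail e ∈ X := by
      intro e he hh
      refine Relation.ReflTransGen.tail hh ⟨(e, false), ?_, ?_, ?_⟩
      · simpa [residual] using he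
      · simp [bidirected]
      · simp [bidirected]
    refine ⟨{e | D.tail e ∈ X ∧ D.head e ∉ X}, ⟨?_, ?_⟩, ?_⟩
    · intro p hp
      obtain ⟨e, hep, heC⟩ := (hsimple p hp).exists_leaving hrX hreach
      exact ⟨e, ⟨heC, hep⟩, fun f hf =>
        (hsimple p hp).leaving_unique hback hf.2 hep hf.1 heC⟩
    · rintro e ⟨ht, hh⟩
      rw [← hmemF]
      by_contra heF
      refine hh (Relation.ReflTransGen.tail ht ⟨(e, true), ?_, ?_, ?_⟩)
      · simpa [residual] using heF
      · simp [bidirected]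
      · simp [bidirected]
    · intro p hp
      exact ((D.isPathIn_iff_isSimplePath _ _ _ _).1 hp).2.exists_leaving hrX hreach

end MultiDigraph

/-- In a finite `r`-rooted digraph, if a maximal element `B` of
`𝒢(D)` is a flame, then `B` is large. -/
theorem stmt14 {V E : Type*} [Fintype V] [Fintype E] (D : MultiDigraph V E) (r : V)
    (hroot : ∀ e, D.head e ≠ r)
    (B : Set E)
    (hmem : D.MemG Set.univ r B)
    (hmax : ∀ B', D.MemG Set.univ r B' → B ⊆ B' → B' = B)
    (hflame : D.IsFlame r B) :
    D.Large r B := by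
  intro v hv
  obtain ⟨-, Ps, hPs, hdis, hcov⟩ := hflame.2.2 v hv
  rcases D.exists_transversal_cut_or_augmentation hv Ps hPs hdis with
    ⟨C, hC, hcut⟩ | ⟨Qs, hQs, hQdis, hQcov, e, hev, heP, heQ⟩
  · exact ⟨Ps, C, hPs, hdis, hC, hcut⟩
  · exfalso
    have heB : e ∉ B := fun he => by
      obtain ⟨p, hp, hep⟩ := hcov e ⟨he, hev⟩
      exact heP p hp hep
    have hins : D.MemG Set.univ r (insert e B) := by
      refine ⟨Set.subset_univ _, fun f _ => hroot f, fun w hw => ?_⟩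
      by_cases hwv : w = v
      · subst hwv
        refine ⟨fun f hf => ⟨trivial, hf.2⟩, Qs, hQs, hQdis, ?_⟩
        rintro f ⟨rfl | hfB, hfv⟩
        · exact heQ
        · obtain ⟨p, hp, hfp⟩ := hcov f ⟨hfB, hfv⟩
          exact hQcov p hp f hfp hfv
      · have : D.delta (insert e B) w = D.delta B w := by
          ext f
          constructor
          · rintro ⟨rfl | hf, hfw⟩
            · exact absurd (hfw.symm.trans hev) hwv
            · exact ⟨hf, hfw⟩
          · exact fun hf => ⟨Set.mem_insert_of_mem _ hf.1, hf.2⟩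
        rw [this]
        exact hmem.2.2 w hw
    exact heB (hmax _ hins (Set.subset_insert _ _) ▸ Set.mem_insert e B)
end

section
/- In any finite r-rooted digraph D = (V,E), the flames in D form a greedoid: if F and F' are flames in D with |F| < |F'|, then there is an edge e ∈ F' \ F such that F ∪ {e} is a flame. -/
namespace MultiDigraph

variable {V E : Type*}

/-- `p` is the edge list of a (possibly empty) directed walk from `s` to `t`. -/
def IsWalk (D : MultiDigraph V E) : V → List E → V → Prop
  | s, [], t => s = t
  | s, e :: p, t => D.tail e = s ∧ D.IsWalk (D.head e) p t

theorem isWalk_iff_isChain (D : MultiDigraph V E) {p : List E} (hne : p ≠ []) {s t : V} :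
    D.IsWalk s p t ↔ D.tail (p.head hne) = s ∧ D.head (p.getLast hne) = t ∧
      p.IsChain (fun e f => D.head e = D.tail f) := by
  induction p generalizing s with
  | nil => exact absurd rfl hne
  | cons e p ih =>
    cases p with
    | nil => simp [IsWalk]
    | cons f q =>
      have := ih (s := D.head e) (by simp)
      simp only [IsWalk, List.head_cons, List.isChain_cons_cons] at this ⊢
      rw [List.getLast_cons (by simp)]
      grind

theorem IsPathIn.isWalk {D : MultiDigraph V E} {L : Set E} {s t : V} {p : List E}
    (h : D.IsPathIn L s t p) : D.IsWalk s p t := by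
  obtain ⟨hne, hs, ht, hc, -⟩ := h
  exact (D.isWalk_iff_isChain hne).2 ⟨hs, ht, hc⟩

theorem IsWalk.concat {D : MultiDigraph V E} {p : List E} {s : V} {e : E}
    (h : D.IsWalk s p (D.tail e)) : D.IsWalk s (p ++ [e]) (D.head e) := by
  induction p generalizing s with
  | nil => exact ⟨Eq.symm h, rfl⟩
  | cons f p ih => exact ⟨h.1, ih h.2⟩

theorem IsWalk.exists_enters {D : MultiDigraph V E} {p : List E} {s t : V} {X : Set V}
    (h : D.IsWalk s p t) (hs : s ∉ X) (ht : t ∈ X) :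
    ∃ e ∈ p, D.tail e ∉ X ∧ D.head e ∈ X := by
  induction p generalizing s with
  | nil => exact absurd (h ▸ ht) hs
  | cons f p ih =>
    by_cases hf : D.head f ∈ X
    · exact ⟨f, by simp, h.1 ▸ hs, hf⟩
    · obtain ⟨e, he, h'⟩ := ih h.2 hf
      exact ⟨e, List.mem_cons_of_mem _ he, h'⟩

theorem IsWalk.exists_suffix {D : MultiDigraph V E} {p : List E} {s t x : V}
    (h : D.IsWalk s p t) (hnd : (s :: p.map D.head).Nodup) (hx : x ∈ s :: p.map D.head) :
    ∃ q, q ⊆ p ∧ D.IsWalk x q t ∧ (x :: q.map D.head).Nodup := by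
  induction p generalizing s with
  | nil =>
    obtain rfl : x = s := by simpa using hx
    exact ⟨[], by simp, h, by simp⟩
  | cons f p ih =>
    rcases List.mem_cons.1 hx with rfl | hx
    · exact ⟨f :: p, fun _ => id, h, hnd⟩
    · obtain ⟨q, hq, h'⟩ := ih h.2 (List.nodup_cons.1 hnd).2 hx
      exact ⟨q, List.Subset.trans hq (List.subset_cons_self _ _), h'⟩

theorem IsWalk.exists_nodup {D : MultiDigraph V E} {p : List E} {s t : V}
    (h : D.IsWalk s p t) :
    ∃ q, q ⊆ p ∧ D.IsWalk s q t ∧ (s :: q.map D.head).Nodup := by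
  induction p generalizing s with
  | nil => exact ⟨[], by simp, h, by simp⟩
  | cons f p ih =>
    obtain ⟨q, hq, hw, hnd⟩ := ih h.2
    by_cases hs : s ∈ D.head f :: q.map D.head
    · obtain ⟨q', hq', h'⟩ := hw.exists_suffix hnd hs
      exact ⟨q', List.Subset.trans (List.Subset.trans hq' hq) (List.subset_cons_self _ _), h'⟩
    · exact ⟨f :: q, List.cons_subset_cons _ hq, ⟨h.1, hw⟩, List.nodup_cons.2 ⟨hs, hnd⟩⟩

theorem IsWalk.exists_isPathIn {D : MultiDigraph V E} {L : Set E} {p : List E} {s t : V}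
    (h : D.IsWalk s p t) (hst : s ≠ t) (hL : ∀ e ∈ p, e ∈ L) :
    ∃ q, q ⊆ p ∧ D.IsPathIn L s t q := by
  obtain ⟨q, hq, hw, hnd⟩ := h.exists_nodup
  have hne : q ≠ [] := by rintro rfl; exact hst hw
  obtain ⟨h1, h2, h3⟩ := (D.isWalk_iff_isChain hne).1 hw
  exact ⟨q, hq, hne, h1, h2, h3, hnd, fun e he => hL e (hq he)⟩

theorem edgesInto_singleton (D : MultiDigraph V E) (L : Set E) (v : V) :
    D.edgesInto L {v} = D.delta L v := by
  ext e
  have := D.no_loops e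
  simp only [edgesInto, delta, Set.mem_ofPred_eq, Set.mem_singleton_iff]
  grind

/-- The in-degree function on vertex sets is submodular. -/
theorem ncard_edgesInto_union_add_inter_le [Finite E] (D : MultiDigraph V E) (L : Set E)
    (X Y : Set V) :
    (D.edgesInto L (X ∪ Y)).ncard + (D.edgesInto L (X ∩ Y)).ncard ≤
      (D.edgesInto L X).ncard + (D.edgesInto L Y).ncard := by
  rw [← Set.ncard_union_add_ncard_inter (D.edgesInto L (X ∪ Y)),
    ← Set.ncard_union_add_ncard_inter (D.edgesInto L X)]
  refine add_le_add (Set.ncard_le_ncard fun e he => ?_) (Set.ncard_le_ncard fun e he => ?_)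
  all_goals
    simp only [edgesInto, Set.mem_union, Set.mem_inter_iff, Set.mem_ofPred_eq] at he ⊢
    tauto

/-- Key step of the proof of Menger's theorem: if every vertex set avoiding `r` has at least as
many ingoing edges as it contains terminals `pos i`, then some edge `e` into the terminal `pos i`
can be deleted and the terminal moved to the tail of `e` so that this condition is preserved. -/
theorem exists_edge_shift [Finite V] [Finite E] {ι : Type*} [Finite ι] [DecidableEq ι]
    (D : MultiDigraph V E) (r : V) (L : Set E) (pos : ι → V)
    (h : ∀ X : Set V, r ∉ X → (pos ⁻¹' X).ncard ≤ (D.edgesInto L X).ncard)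
    (i : ι) (hi : pos i ≠ r) :
    ∃ e ∈ L, D.head e = pos i ∧ ∀ X : Set V, r ∉ X →
      (Function.update pos i (D.tail e) ⁻¹' X).ncard ≤ (D.edgesInto (L \ {e}) X).ncard := by
  obtain ⟨Y, hY, hmax⟩ := Set.Finite.exists_maximal
    (s := {X : Set V | r ∉ X ∧ pos i ∉ X ∧ (D.edgesInto L X).ncard ≤ (pos ⁻¹' X).ncard})
    (Set.toFinite _) ⟨∅, by simp [edgesInto]⟩
  obtain ⟨hrY, hiY, htY⟩ := hY
  obtain ⟨e, heL, heh, het⟩ : ∃ e ∈ L, D.head e = pos i ∧ D.tail e ∉ Y := by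
    by_contra! hcon
    have h1 := h (insert (pos i) Y) (by simp [hrY, hi.symm])
    have h2 : D.edgesInto L (insert (pos i) Y) ⊆ D.edgesInto L Y := by
      rintro e ⟨he, h3, h4⟩
      simp only [Set.mem_insert_iff, not_or] at h3 h4
      rcases h4 with h4 | h4
      · exact absurd (hcon e he h4) h3.2
      · exact ⟨he, h3.2, h4⟩
    have h3 : pos ⁻¹' Y ⊂ pos ⁻¹' (insert (pos i) Y) :=
      ⟨fun j hj => Or.inr hj, fun hsub => hiY (hsub (Set.mem_insert (pos i) Y))⟩
    have := Set.ncard_le_ncard h2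
    have := Set.ncard_lt_ncard h3
    omega
  refine ⟨e, heL, heh, fun X hrX => ?_⟩
  have hX := h X hrX
  by_cases hhead : pos i ∈ X
  · by_cases htail : D.tail e ∈ X
    · have h1 : Function.update pos i (D.tail e) ⁻¹' X = pos ⁻¹' X := by
        ext j
        by_cases hj : j = i
        · subst hj; simp [hhead, htail]
        · simp [hj]
      have h2 : D.edgesInto (L \ {e}) X = D.edgesInto L X := by
        ext f
        simp only [edgesInto, Set.mem_ofPred_eq, Set.mem_sdiff, Set.mem_singleton_iff]
        grind
      rwa [h1, h2]
    · have h1 : Function.update pos i (D.tail e) ⁻¹' X = pos ⁻¹' X \ {i} := by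
        ext j
        by_cases hj : j = i
        · subst hj; simp [htail]
        · simp [hj]
      have h2 : D.edgesInto (L \ {e}) X = D.edgesInto L X \ {e} := by
        ext f
        simp only [edgesInto, Set.mem_ofPred_eq, Set.mem_sdiff, Set.mem_singleton_iff]
        tauto
      rw [h1, h2, Set.ncard_sdiff_singleton_of_mem (by exact hhead),
        Set.ncard_sdiff_singleton_of_mem (a := e) (s := D.edgesInto L X)
          ⟨heL, htail, by rwa [heh]⟩]
      omega
  · have h2 : D.edgesInto (L \ {e}) X = D.edgesInto L X := by
      ext f
      simp only [edgesInto, Set.mem_ofPred_eq, Set.mem_sdiff, Set.mem_singleton_iff]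
      grind
    rw [h2]
    by_cases htail : D.tail e ∈ X
    · have h1 : Function.update pos i (D.tail e) ⁻¹' X ⊆ insert i (pos ⁻¹' X) := by
        intro j hj
        by_cases hji : j = i
        · exact Or.inl hji
        · exact Or.inr (by simpa [hji] using hj)
      refine (Set.ncard_le_ncard h1).trans ((Set.ncard_insert_le _ _).trans ?_)
      by_contra! hlt
      have hsub := D.ncard_edgesInto_union_add_inter_le L X Y
      have hmod := Set.ncard_union_add_ncard_inter (pos ⁻¹' X) (pos ⁻¹' Y)
      rw [← Set.preimage_union, ← Set.preimage_inter] at hmod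
      have hint := h (X ∩ Y) fun hr => hrX hr.1
      have := hmax (y := X ∪ Y) ⟨by simp [hrX, hrY], by simp [hhead, hiY], by omega⟩
        Set.subset_union_right
      exact het (this (Or.inl htail))
    · refine le_trans (Set.ncard_le_ncard fun j hj => ?_) hX
      by_cases hji : j = i
      · subst hji; simp [htail] at hj
      · simpa [hji] using hj

/-- Menger's theorem for edge-disjoint walks from `r` to prescribed terminals. -/
theorem exists_disjoint_walks [Finite V] [Finite E] {ι : Type*} [Finite ι]
    (D : MultiDigraph V E) (r : V) (L : Set E) (pos : ι → V)
    (h : ∀ X : Set V, r ∉ X → (pos ⁻¹' X).ncard ≤ (D.edgesInto L X).ncard) :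
    ∃ P : ι → List E, (∀ i, D.IsWalk r (P i) (pos i)) ∧ (∀ i, ∀ e ∈ P i, e ∈ L) ∧
      Pairwise fun i j => (P i).Disjoint (P j) := by
  classical
  induction hn : L.ncard generalizing L pos with
  | zero =>
    have hL : L = ∅ := (Set.ncard_eq_zero).1 hn
    refine ⟨fun _ => [], fun i => ?_, by simp, fun i j _ => by simp⟩
    by_contra hi
    have hi : pos i ≠ r := fun h => hi h.symm
    obtain ⟨e, he, -⟩ := D.exists_edge_shift r L pos h i hi
    simp [hL] at he
  | succ n ih =>
    by_cases hall : ∀ i, pos i = r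
    · exact ⟨fun _ => [], fun i => (hall i).symm, by simp, fun i j _ => by simp⟩
    obtain ⟨i, hi⟩ := not_forall.1 hall
    obtain ⟨e, he, hei, h'⟩ := D.exists_edge_shift r L pos h i hi
    obtain ⟨P, hP, hPL, hPd⟩ := ih _ _ h' (by rw [Set.ncard_sdiff_singleton_of_mem he, hn]; rfl)
    have hPe : ∀ j, e ∉ P j := fun j hj => (hPL j e hj).2 rfl
    refine ⟨Function.update P i (P i ++ [e]), fun j => ?_, fun j f hf => ?_, fun j k hjk => ?_⟩
    · by_cases hj : j = i
      · subst hj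
        have := hP j
        rw [Function.update_self] at this ⊢
        exact hei ▸ this.concat
      · simpa [hj] using hP j
    · by_cases hj : j = i
      · subst hj
        rw [Function.update_self] at hf
        rcases List.mem_append.1 hf with hf | hf
        · exact (hPL j f hf).1
        · exact List.mem_singleton.1 hf ▸ he
      · rw [Function.update_of_ne hj] at hf
        exact (hPL j f hf).1
    · by_cases hj : j = i
      · subst hj
        rw [Function.update_self, Function.update_of_ne hjk.symm]
        simpa [hPe] using hPd hjk
      · by_cases hk : k = i
        · subst hk
          rw [Function.update_self, Function.update_of_ne hj]
          simpa [hPe] using hPd hjk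
        · simpa only [Function.update_of_ne hj, Function.update_of_ne hk] using hPd hjk

/-- All ingoing edges of `v` can be covered by edge-disjoint `r`–`v` paths if and only if
no vertex set containing `v` but not `r` has fewer ingoing edges than `v`. -/
theorem memGv_delta_iff [Finite V] [Finite E] (D : MultiDigraph V E) {r v : V} (hv : v ≠ r)
    (L : Set E) :
    D.MemGv L r v (D.delta L v) ↔
      ∀ X : Set V, r ∉ X → v ∈ X → (D.delta L v).ncard ≤ (D.edgesInto L X).ncard := by
  constructor
  · rintro ⟨-, Ps, hPs, hd, hcov⟩ X hrX hvX
    choose! p hp hmem using hcov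
    have hex : ∀ e ∈ D.delta L v, ∃ f ∈ p e, D.tail f ∉ X ∧ D.head f ∈ X :=
      fun e he => (hPs _ (hp e he)).isWalk.exists_enters hrX hvX
    choose! f hf hfX using hex
    refine Set.ncard_le_ncard_of_injOn f (fun e he => ?_) fun e he e' he' hee => ?_
    · obtain ⟨_, _, _, _, _, hL⟩ := hPs _ (hp e he)
      exact ⟨hL _ (hf e he), hfX e he⟩
    · have hpp : p e = p e' := by
        by_contra hne
        exact hd (hp e he) (hp e' he') hne (hf e he) (hee ▸ hf e' he')
      obtain ⟨_, _, _, _, hnd, _⟩ := hPs _ (hp e he)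
      exact List.inj_on_of_nodup_map (List.nodup_cons.1 hnd).2 (hmem e he)
        (hpp ▸ hmem e' he') (he.2.trans he'.2.symm)
  · intro h
    obtain ⟨W, hW, hWL, hWd⟩ := D.exists_disjoint_walks r L (fun _ : D.delta L v => v)
      fun X hrX => by
        by_cases hvX : v ∈ X
        · simpa [hvX, Set.ncard_univ, Nat.card_coe_set_eq] using h X hrX hvX
        · simp [hvX]
    choose p hpW hp using fun i => (hW i).exists_isPathIn hv.symm (hWL i)
    have hpd : Pairwise fun i j => (p i).Disjoint (p j) :=
      fun i j hij a hi hj => hWd hij (hpW i hi) (hpW j hj)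
    have hlast : ∀ i, ∃ e : D.delta L v, (e : E) ∈ p i := fun i => by
      obtain ⟨hne, -, ht, -, -, hL⟩ := hp i
      exact ⟨⟨(p i).getLast hne, hL _ (List.getLast_mem hne), ht⟩, List.getLast_mem hne⟩
    choose l hl using hlast
    have hinj : Function.Injective l := fun i j hij => by
      by_contra hne
      exact hpd hne (hl i) (hij ▸ hl j)
    refine ⟨subset_rfl, Set.range p, ?_, ?_, fun e he => ?_⟩
    · rintro _ ⟨i, rfl⟩
      exact hp i
    · rintro _ ⟨i, rfl⟩ _ ⟨j, rfl⟩ hij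
      exact hpd fun h => hij (h ▸ rfl)
    · obtain ⟨i, hi⟩ := (Finite.surjective_of_injective hinj) ⟨e, he⟩
      exact ⟨p i, ⟨i, rfl⟩, by simpa [hi] using hl i⟩

theorem isFlame_iff [Finite V] [Finite E] (D : MultiDigraph V E) {r : V}
    (hroot : ∀ e, D.head e ≠ r) (F : Set E) :
    D.IsFlame r F ↔ ∀ v, ∀ X : Set V, r ∉ X → v ∈ X →
      (D.delta F v).ncard ≤ (D.edgesInto F X).ncard := by
  constructor
  · rintro ⟨-, -, h⟩ v X hrX hvX
    have hv : v ≠ r := fun h => hrX (h ▸ hvX)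
    exact (D.memGv_delta_iff hv F).1 (h v hv) X hrX hvX
  · exact fun h => ⟨subset_rfl, fun e _ => hroot e,
      fun v hv => (D.memGv_delta_iff hv F).2 (h v)⟩

/-- A flame `F` can be extended by an edge `e` if `e` enters every vertex set that avoids `r`,
contains the head `v` of `e` and has no more ingoing edges in `F` than `v`. -/
theorem IsFlame.insert_edge [Finite V] [Finite E] {D : MultiDigraph V E} {r : V}
    (hroot : ∀ e, D.head e ≠ r) {F : Set E} (hF : D.IsFlame r F) {e : E} (heF : e ∉ F)
    (h : ∀ X : Set V, r ∉ X → D.head e ∈ X →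
      (D.edgesInto F X).ncard ≤ (D.delta F (D.head e)).ncard → D.tail e ∉ X) :
    D.IsFlame r (insert e F) := by
  rw [isFlame_iff D hroot] at hF ⊢
  intro v X hrX hvX
  have hFX := hF v X hrX hvX
  have hmono : (D.edgesInto F X).ncard ≤ (D.edgesInto (insert e F) X).ncard :=
    Set.ncard_le_ncard fun f hf => ⟨Or.inr hf.1, hf.2⟩
  by_cases hev : D.head e = v
  · subst hev
    have h1 : D.delta (insert e F) (D.head e) ⊆
        insert e (D.delta F (D.head e)) := by
      rintro f ⟨hf | hf, hfe⟩
      · exact Or.inl hf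
      · exact Or.inr ⟨hf, hfe⟩
    have h2 := (Set.ncard_le_ncard h1).trans (Set.ncard_insert_le _ _)
    by_cases htight : (D.edgesInto F X).ncard ≤ (D.delta F (D.head e)).ncard
    · have h3 : insert e (D.edgesInto F X) ⊆ D.edgesInto (insert e F) X := by
        rintro f (rfl | hf)
        · exact ⟨Or.inl rfl, h X hrX hvX htight, hvX⟩
        · exact ⟨Or.inr hf.1, hf.2⟩
      have h4 := Set.ncard_le_ncard h3
      rw [Set.ncard_insert_of_notMem fun hf => heF hf.1] at h4
      omega
    · omega
  · have h1 : D.delta (insert e F) v ⊆ D.delta F v := by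
      rintro f ⟨rfl | hf, hfv⟩
      · exact absurd hfv hev
      · exact ⟨hf, hfv⟩
    exact (Set.ncard_le_ncard h1).trans (hFX.trans hmono)

theorem exists_ncard_delta_lt [Fintype V] [Fintype E] (D : MultiDigraph V E) {F F' : Set E}
    (h : F.ncard < F'.ncard) : ∃ v, (D.delta F v).ncard < (D.delta F' v).ncard := by
  classical
  have key : ∀ L : Set E, L.ncard = ∑ v, (D.delta L v).ncard := fun L => by
    rw [Set.ncard_eq_toFinset_card',
      Finset.card_eq_sum_card_fiberwise (f := D.head) (t := Finset.univ) (by simp)]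
    refine Finset.sum_congr rfl fun v _ => ?_
    rw [Set.ncard_eq_toFinset_card']
    congr 1
    ext e
    simp only [Finset.mem_filter, Set.mem_toFinset]
    rfl
  rw [key F, key F'] at h
  obtain ⟨v, -, hv⟩ := Finset.exists_lt_of_sum_lt h
  exact ⟨v, hv⟩

end MultiDigraph

/-- In any finite `r`-rooted digraph, the flames form a greedoid:
if `F` and `F'` are flames with `|F| < |F'|`, then there is `e ∈ F' \\ F` such that
`F ∪ {e}` is a flame. -/
theorem stmt16 {V E : Type*} [Fintype V] [Fintype E] (D : MultiDigraph V E) (r : V)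
    (hroot : ∀ e, D.head e ≠ r)
    (F F' : Set E)
    (hF : D.IsFlame r F) (hF' : D.IsFlame r F')
    (hcard : F.ncard < F'.ncard) :
    ∃ e ∈ F' \ F, D.IsFlame r (insert e F) := by
  obtain ⟨v, hv⟩ := D.exists_ncard_delta_lt hcard
  have hvr : v ≠ r := by
    rintro rfl
    simp [MultiDigraph.delta, hroot] at hv
  have hf := (D.isFlame_iff hroot F).1 hF
  obtain ⟨T, ⟨hrT, hvT, hT⟩, hmax⟩ := Set.Finite.exists_maximal
    (s := {X : Set V | r ∉ X ∧ v ∈ X ∧ (D.edgesInto F X).ncard ≤ (D.delta F v).ncard})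
    (Set.toFinite _) ⟨{v}, by simp [hvr.symm, D.edgesInto_singleton]⟩
  have hT' := (D.isFlame_iff hroot F').1 hF' v T hrT hvT
  obtain ⟨e, ⟨heF', het, heh⟩, hnot⟩ :=
    Set.exists_mem_notMem_of_ncard_lt_ncard (hT.trans_lt (hv.trans_le hT'))
  have heF : e ∉ F := fun he => hnot ⟨he, het, heh⟩
  refine ⟨e, ⟨heF', heF⟩, hF.insert_edge hroot heF fun X hrX hX htight htX => ?_⟩
  have hsub := D.ncard_edgesInto_union_add_inter_le F X T
  have hint := hf (D.head e) (X ∩ T) (fun h => hrX h.1) ⟨hX, heh⟩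
  exact het (hmax (y := X ∪ T) ⟨by simp [hrX, hrT], Or.inr hvT, by omega⟩
    Set.subset_union_right (Or.inl htX))
end

section
/- If D = (V,E) is a finite acyclic r-rooted digraph, then every maximal element of G(D) is large (Szeszlér's theorem). -/
section Linking

open Finset Classical

variable {E : Type*}

/-- The elements of `W` that lie in `A` or have an `R`-predecessor outside `W`; every `R`-chain
from `A` to `W` meets this set. -/
noncomputable def innerBoundary (R : E → E → Prop) (A : Set E) (W : Finset E) : Finset E :=
  W.filter fun e => e ∈ A ∨ ∃ f, R f e ∧ f ∉ W

/-- The Ingleton–Piff matching form of the statement that `J` is the set of terminal elements of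
a family of disjoint `R`-chains starting in `A`. -/
def IsLinked (R : E → E → Prop) (A : Set E) (J : Finset E) : Prop :=
  ∃ g : E → E, Set.InjOn g Aᶜ ∧ ∀ x ∉ A, g x ∉ J ∧ (g x = x ∨ R (g x) x)

/-- `Z` is an inclusion-maximal superset of `S` among those with smallest boundary. -/
def IsTightHull (R : E → E → Prop) (A : Set E) (S Z : Finset E) : Prop :=
  S ⊆ Z ∧ (∀ Y, S ⊆ Y → #(innerBoundary R A Z) ≤ #(innerBoundary R A Y)) ∧
    ∀ Y, Z ⊆ Y → #(innerBoundary R A Y) ≤ #(innerBoundary R A Z) → Y ⊆ Z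

variable {R : E → E → Prop} {A : Set E}

theorem mem_innerBoundary {W : Finset E} {e : E} :
    e ∈ innerBoundary R A W ↔ e ∈ W ∧ (e ∈ A ∨ ∃ f, R f e ∧ f ∉ W) := by
  simp [innerBoundary]

theorem innerBoundary_subset (W : Finset E) : innerBoundary R A W ⊆ W :=
  filter_subset _ _

theorem exists_mem_innerBoundary_of_isChain {W : Finset E} (p : List E) (hne : p ≠ [])
    (hp : p.IsChain R) (hlast : p.getLast hne ∈ W)
    (hhead : p.head hne ∈ A ∨ ∃ f, R f (p.head hne) ∧ f ∉ W) :
    ∃ e ∈ p, e ∈ innerBoundary R A W := by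
  induction p with
  | nil => exact absurd rfl hne
  | cons a p ih =>
    by_cases ha : a ∈ W
    · exact ⟨a, by simp, mem_innerBoundary.2 ⟨ha, hhead⟩⟩
    have hp' : p ≠ [] := by
      rintro rfl
      exact ha hlast
    rw [List.getLast_cons hp'] at hlast
    obtain ⟨b, q, rfl⟩ := List.exists_cons_of_ne_nil hp'
    rw [List.isChain_cons_cons] at hp
    obtain ⟨e, he, heW⟩ := ih hp' hp.2 hlast (Or.inr ⟨a, hp.1, ha⟩)
    exact ⟨e, List.mem_cons_of_mem _ he, heW⟩

/-- A linked set yields a family of disjoint `R`-chains from `A`. -/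
theorem IsLinked.exists_chains {J : Finset E} (h : IsLinked R A J) (ht : E → ℕ)
    (hht : ∀ e f, R e f → ht e < ht f) :
    ∃ P : E → List E,
      (∀ i ∈ J, ∃ hne : P i ≠ [], (P i).head hne ∈ A ∧ (P i).getLast hne = i ∧
        (P i).IsChain R) ∧
      ∀ i ∈ J, ∀ j ∈ J, i ≠ j → (P i).Disjoint (P j) := by
  obtain ⟨g, hinj, hg⟩ := h
  have main : ∀ n e, ht e = n → (e ∉ A → g e ≠ e) → ∃ p : List E, ∃ hne : p ≠ [],
      p.head hne ∈ A ∧ p.getLast hne = e ∧ p.IsChain R ∧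
      ∀ x ∈ p, ∃ m, g^[m] e = x ∧ ∀ k < m, g^[k] e ∉ A := by
    intro n
    induction n using Nat.strong_induction_on with
    | _ n ih =>
      intro e hen hact
      by_cases heA : e ∈ A
      · exact ⟨[e], by simp, heA, rfl, by simp, fun x hx => ⟨0, by simp_all, by simp⟩⟩
      have hR : R (g e) e := (hg e heA).2.resolve_left (hact heA)
      obtain ⟨p, hne, hhead, hlast, hchain, hmem⟩ := ih (ht (g e)) (hen ▸ hht _ _ hR) (g e) rfl
        (fun hA hgg => hact heA (hinj hA heA hgg))
      refine ⟨p ++ [e], by simp, ?_, by simp, ?_, ?_⟩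
      · rwa [List.head_append_of_ne_nil hne]
      · rw [List.isChain_append]
        refine ⟨hchain, by simp, ?_⟩
        intro x hx y hy
        rw [List.getLast?_eq_getLast_of_ne_nil hne] at hx
        simp only [Option.mem_def, Option.some.injEq, List.head?_cons] at hx hy
        rw [← hx, ← hy, hlast]
        exact hR
      · intro x hx
        rcases List.mem_append.1 hx with hx | hx
        · obtain ⟨m, hm, hk⟩ := hmem x hx
          refine ⟨m + 1, by simpa using hm, fun k hkm => ?_⟩
          cases k with
          | zero => exact heA
          | succ k => simpa using hk k (by omega)
        · exact ⟨0, by simp_all, by simp⟩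
  have main' : ∀ i, ∃ p : List E, i ∈ J → ∃ hne : p ≠ [],
      p.head hne ∈ A ∧ p.getLast hne = i ∧ p.IsChain R ∧
      ∀ x ∈ p, ∃ m, g^[m] i = x ∧ ∀ k < m, g^[k] i ∉ A := by
    intro i
    by_cases hi : i ∈ J
    · obtain ⟨p, hp⟩ := main _ i rfl (fun hA hgi => (hg i hA).1 (by rwa [hgi]))
      exact ⟨p, fun _ => hp⟩
    · exact ⟨[], fun h => absurd h hi⟩
  choose P hP using main'
  have inj : ∀ m n i j, i ∈ J → j ∈ J → (∀ k < m, g^[k] i ∉ A) → (∀ k < n, g^[k] j ∉ A) →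
      g^[m] i = g^[n] j → i = j := by
    intro m
    induction m with
    | zero =>
      intro n i j hi hj _ hnj h
      cases n with
      | zero => exact h
      | succ n =>
        rw [Function.iterate_succ_apply'] at h
        exact absurd (h ▸ hi) (hg _ (hnj n (by omega))).1
    | succ m ih =>
      intro n i j hi hj hmi hnj h
      rw [Function.iterate_succ_apply'] at h
      cases n with
      | zero => exact absurd (h ▸ hj) (hg _ (hmi m (by omega))).1
      | succ n =>
        rw [Function.iterate_succ_apply'] at h
        exact ih n i j hi hj (fun k hk => hmi k (by omega)) (fun k hk => hnj k (by omega))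
          (hinj (hmi m (by omega)) (hnj n (by omega)) h)
  refine ⟨P, fun i hi => ?_, fun i hi j hj hij x hxi hxj => hij ?_⟩
  · obtain ⟨hne, h1, h2, h3, -⟩ := hP i hi
    exact ⟨hne, h1, h2, h3⟩
  · obtain ⟨_, _, _, _, h⟩ := hP i hi
    obtain ⟨_, _, _, _, h'⟩ := hP j hj
    obtain ⟨m, hm, hmk⟩ := h x hxi
    obtain ⟨n, hn, hnk⟩ := h' x hxj
    exact inj m n i j hi hj hmk hnk (hm.trans hn.symm)

theorem IsLinked.card_le {J W : Finset E} (h : IsLinked R A J) (hJW : J ⊆ W) :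
    #J ≤ #(innerBoundary R A W) := by
  obtain ⟨g, hinj, hg⟩ := h
  have key : #(W \ innerBoundary R A W) ≤ #(W \ J) := by
    have hA : ∀ x ∈ W \ innerBoundary R A W, x ∉ A ∧ ∀ f, R f x → f ∈ W := by
      intro x hx
      simp only [mem_sdiff, mem_innerBoundary, not_and, not_or, not_exists, not_not] at hx
      exact hx.2 hx.1
    refine card_le_card_of_injOn g ?_ ?_
    · intro x hx
      have hx' := hA x hx
      have hxW : x ∈ W := (mem_sdiff.1 hx).1
      rcases hg x hx'.1 with ⟨h1, h2 | h2⟩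
      · simp only [coe_sdiff, Set.mem_sdiff, mem_coe]
        exact ⟨by rwa [h2], h1⟩
      · simp only [coe_sdiff, Set.mem_sdiff, mem_coe]
        exact ⟨hx'.2 _ h2, h1⟩
    · intro x hx y hy
      exact hinj (hA x hx).1 (hA y hy).1
  have h1 := card_sdiff_add_card_eq_card (innerBoundary_subset (R := R) (A := A) W)
  have h2 := card_sdiff_add_card_eq_card hJW
  omega

theorem exists_card_innerBoundary_lt [Fintype E] {J : Finset E} (h : ¬ IsLinked R A J) :
    ∃ W, J ⊆ W ∧ #(innerBoundary R A W) < #J := by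
  let t : {x // x ∉ A} → Finset E := fun x =>
    univ.filter fun y => (y = x.1 ∨ R y x.1) ∧ y ∉ J
  have hall : ¬ ∀ s : Finset {x // x ∉ A}, #s ≤ #(s.biUnion t) := by
    intro hs
    obtain ⟨f, hf, hft⟩ := (all_card_le_biUnion_card_iff_exists_injective t).1 hs
    refine h ⟨fun x => if hx : x ∉ A then f ⟨x, hx⟩ else x, ?_, ?_⟩
    · intro x hx y hy hxy
      have hx' : x ∉ A := hx
      have hy' : y ∉ A := hy
      simp only [hx', hy', not_false_eq_true, dif_pos] at hxy
      simpa using hf hxy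
    · intro x hx
      have := hft ⟨x, hx⟩
      simp only [t, mem_filter, mem_univ, true_and] at this
      simp only [hx, not_false_eq_true, dif_pos]
      exact ⟨this.2, this.1⟩
  push Not at hall
  obtain ⟨s, hs⟩ := hall
  let T : Finset E := s.map (Function.Embedding.subtype _)
  have hT : #T = #s := card_map _
  have hTsub : T ⊆ s.biUnion t ∪ J := by
    intro x hx
    obtain ⟨y, hy, rfl⟩ := mem_map.1 hx
    by_cases hJ : y.1 ∈ J
    · exact mem_union_right _ hJ
    · refine mem_union_left _ (mem_biUnion.2 ⟨y, hy, ?_⟩)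
      simp [t, hJ]
  refine ⟨s.biUnion t ∪ J, subset_union_right, ?_⟩
  have hsub : innerBoundary R A (s.biUnion t ∪ J) ⊆ (s.biUnion t ∪ J) \ T := by
    intro x hx
    rw [mem_innerBoundary] at hx
    refine mem_sdiff.2 ⟨hx.1, fun hxT => ?_⟩
    obtain ⟨y, hy, rfl⟩ := mem_map.1 hxT
    rcases hx.2 with h1 | ⟨f, hf, hfn⟩
    · exact y.2 h1
    · rw [mem_union, not_or] at hfn
      refine hfn.1 (mem_biUnion.2 ⟨y, hy, ?_⟩)
      simp only [t, mem_filter, mem_univ, true_and]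
      exact ⟨Or.inr hf, hfn.2⟩
  have h1 := card_le_card hsub
  have h2 := card_sdiff_add_card_eq_card hTsub
  have h3 := card_union_le (s.biUnion t) J
  omega

theorem card_innerBoundary_union_add_inter_le (Z W : Finset E) :
    #(innerBoundary R A (Z ∪ W)) + #(innerBoundary R A (Z ∩ W)) ≤
      #(innerBoundary R A Z) + #(innerBoundary R A W) := by
  rw [← card_union_add_card_inter, ← card_union_add_card_inter (innerBoundary R A Z)]
  refine Nat.add_le_add (card_le_card ?_) (card_le_card ?_)
  · intro e
    simp only [mem_union, mem_inter, mem_innerBoundary]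
    grind
  · intro e
    simp only [mem_union, mem_inter, mem_innerBoundary]
    grind

theorem exists_isTightHull [Fintype E] (S : Finset E) : ∃ Z, IsTightHull R A S Z := by
  obtain ⟨Y, hY, hYmin⟩ := exists_min_image (univ.filter fun Y : Finset E => S ⊆ Y)
    (fun Y => #(innerBoundary R A Y)) ⟨S, by simp⟩
  obtain ⟨Z, hZ, hZmax⟩ := exists_max_image
    (univ.filter fun Z : Finset E =>
      S ⊆ Z ∧ #(innerBoundary R A Z) ≤ #(innerBoundary R A Y))
    card ⟨Y, by simpa using hY⟩
  simp only [mem_filter, mem_univ, true_and, and_imp] at hY hYmin hZ hZmax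
  refine ⟨Z, hZ.1, fun X hX => hZ.2.trans (hYmin X hX), fun X hZX hX => ?_⟩
  exact (eq_of_subset_of_card_le hZX (hZmax X (hZ.1.trans hZX) (hX.trans hZ.2))).ge

theorem IsTightHull.card_le {S Z : Finset E} (h : IsTightHull R A S Z) :
    #(innerBoundary R A Z) ≤ #S :=
  (h.2.1 S Subset.rfl).trans (card_le_card (innerBoundary_subset S))

theorem IsTightHull.subset_of_card_le {S Z J W : Finset E} (h : IsTightHull R A S Z)
    (hJ : ∀ Y, J ⊆ Y → #J ≤ #(innerBoundary R A Y)) (hJZ : J ⊆ Z) (hJW : J ⊆ W)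
    (hW : #(innerBoundary R A W) ≤ #J) : W ⊆ Z := by
  refine subset_union_right.trans (h.2.2 (Z ∪ W) subset_union_left ?_)
  have h1 := card_innerBoundary_union_add_inter_le (R := R) (A := A) Z W
  have h2 := hJ (Z ∩ W) (subset_inter hJZ hJW)
  omega

theorem IsTightHull.mem_of_forall_pred {S Z : Finset E} (h : IsTightHull R A S Z) {e : E}
    (heA : e ∉ A) (he : ∀ f, R f e → f ∈ Z) : e ∈ Z := by
  refine h.2.2 (insert e Z) (subset_insert _ _) (card_le_card ?_) (mem_insert_self _ _)
  intro x
  simp only [mem_innerBoundary, mem_insert]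
  grind

/-- The theorem of Menger in terms of linked sets. -/
theorem exists_isLinked_subset [Fintype E] (S : Finset E) :
    ∃ I Z, I ⊆ S ∧ IsLinked R A I ∧ S ⊆ Z ∧ #(innerBoundary R A Z) ≤ #I := by
  obtain ⟨I, hI, hImax⟩ := exists_max_image
    (univ.filter fun I : Finset E => I ⊆ S ∧ IsLinked R A I) card
    ⟨∅, by simpa using ⟨id, Set.injOn_id _, by simp⟩⟩
  simp only [mem_filter, mem_univ, true_and, and_imp] at hI hImax
  obtain ⟨Z, hZ⟩ := exists_isTightHull (R := R) (A := A) I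
  refine ⟨I, Z, hI.1, hI.2, fun e he => ?_, hZ.card_le⟩
  by_cases heI : e ∈ I
  · exact hZ.1 heI
  have hnot : ¬ IsLinked R A (insert e I) := fun hl => by
    have := hImax _ (insert_subset he hI.1) hl
    rw [card_insert_of_notMem heI] at this
    omega
  obtain ⟨W, hW, hWc⟩ := exists_card_innerBoundary_lt hnot
  rw [card_insert_of_notMem heI] at hWc
  exact hZ.subset_of_card_le (fun Y hY => hI.2.card_le hY) hZ.1
    ((subset_insert _ _).trans hW) (by omega) (hW (mem_insert_self _ _))

end Linking

namespace MultiDigraph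

open Finset Classical

section Acyclic

variable {V E : Type*} {D : MultiDigraph V E}

theorem hasCycle_of_closed_walk (p : List E) (hne : p ≠ [])
    (hp : p.IsChain fun e f => D.head e = D.tail f)
    (hcl : D.head (p.getLast hne) = D.tail (p.head hne)) : D.HasCycle := by
  induction hn : p.length using Nat.strong_induction_on generalizing p with
  | _ n ih =>
    by_cases hnd : (p.map D.head).Nodup
    · exact ⟨p, hne, hp, hcl, hnd⟩
    rw [List.Nodup, List.pairwise_iff_getElem] at hnd
    push Not at hnd
    obtain ⟨i, j, hi, hj, hij, heq⟩ := hnd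
    simp only [List.length_map] at hi hj
    simp only [List.getElem_map] at heq
    have hlen : ((p.take (j + 1)).drop (i + 1)).length = j - i := by
      simp only [List.length_drop, List.length_take]
      omega
    have hqne : (p.take (j + 1)).drop (i + 1) ≠ [] := by
      rw [← List.length_pos_iff_ne_nil]
      omega
    refine ih (j - i) (by omega) ((p.take (j + 1)).drop (i + 1)) hqne
      ((hp.take _).drop _) ?_ hlen
    have h1 : ((p.take (j + 1)).drop (i + 1)).getLast hqne = p[j] := by
      rw [List.getLast_eq_getElem]
      simp only [List.getElem_drop, List.getElem_take]
      congr 1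
      omega
    have h2 : ((p.take (j + 1)).drop (i + 1)).head hqne = p[i + 1] := by
      rw [List.head_eq_getElem]
      simp only [List.getElem_drop, List.getElem_take, Nat.add_zero]
    rw [h1, h2, ← heq]
    exact List.isChain_iff_getElem.1 hp i (by omega)

theorem exists_height [Finite V] (hacyclic : ¬ D.HasCycle) :
    ∃ ht : V → ℕ, ∀ e, ht (D.tail e) < ht (D.head e) := by
  let adj : V → V → Prop := fun u w => ∃ e, D.tail e = u ∧ D.head e = w
  have walk : ∀ u w, Relation.TransGen adj u w → ∃ p : List E, ∃ hne : p ≠ [],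
      (p.IsChain fun e f => D.head e = D.tail f) ∧
      D.tail (p.head hne) = u ∧ D.head (p.getLast hne) = w := by
    intro u w h
    induction h with
    | single h =>
      obtain ⟨e, he, he'⟩ := h
      exact ⟨[e], by simp, by simp, he, he'⟩
    | tail _ h ih =>
      obtain ⟨e, he, he'⟩ := h
      obtain ⟨p, hne, hp, h1, h2⟩ := ih
      refine ⟨p ++ [e], by simp, ?_, ?_, by simpa using he'⟩
      · rw [List.isChain_append]
        refine ⟨hp, by simp, ?_⟩
        intro x hx y hy
        rw [List.getLast?_eq_getLast_of_ne_nil hne] at hx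
        simp only [Option.mem_def, Option.some.injEq, List.head?_cons] at hx hy
        rw [← hx, ← hy, h2, he]
      · rwa [List.head_append_of_ne_nil hne]
  refine ⟨fun w => Set.ncard {u | Relation.TransGen adj u w}, fun e => ?_⟩
  have hadj : adj (D.tail e) (D.head e) := ⟨e, rfl, rfl⟩
  refine Set.ncard_lt_ncard ⟨fun u hu => Relation.TransGen.tail hu hadj, fun hsub => ?_⟩
    (Set.toFinite _)
  obtain ⟨p, hne, hp, h1, h2⟩ := walk _ _ (hsub (Relation.TransGen.single hadj))
  exact hacyclic (hasCycle_of_closed_walk p hne hp (h2.trans h1.symm))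

theorem nodup_map_head {ht : V → ℕ} (hht : ∀ e, ht (D.tail e) < ht (D.head e)) {p : List E}
    (hp : p.IsChain fun e f => D.head e = D.tail f) : (p.map D.head).Nodup := by
  have h1 : p.IsChain fun e f => ht (D.head e) < ht (D.head f) :=
    hp.imp fun e f h => by rw [h]; exact hht f
  have : IsTrans E fun e f => ht (D.head e) < ht (D.head f) := ⟨fun _ _ _ => lt_trans⟩
  rw [List.Nodup, List.pairwise_map]
  exact (List.isChain_iff_pairwise.1 h1).imp fun h h' => by simp [h'] at h

end Acyclic

section Paths

variable {V E : Type*} {D : MultiDigraph V E} {L : Set E} {r v : V}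

/-- `e` is an edge of `D(L)` whose head is the tail of `f`. -/
def Precedes (D : MultiDigraph V E) (L : Set E) (e f : E) : Prop :=
  e ∈ L ∧ D.head e = D.tail f

theorem IsPathIn.eq_getLast {p : List E} (hp : D.IsPathIn L r v p) {e : E} (he : e ∈ p)
    (hev : D.head e = v) : p.getLast hp.1 = e := by
  obtain ⟨hne, -, hlast, -, hnd, -⟩ := hp
  exact List.inj_on_of_nodup_map (List.nodup_cons.1 hnd).2 (List.getLast_mem hne) he
    (hlast.trans hev.symm)

theorem IsPathIn.exists_mem_innerBoundary {p : List E} (hp : D.IsPathIn L r v p)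
    {W : Finset E} (hW : p.getLast hp.1 ∈ W) :
    ∃ e ∈ p, e ∈ innerBoundary (D.Precedes Set.univ) {e | D.tail e = r} W := by
  have ⟨hne, hhead, _, hchain, _, _⟩ := hp
  exact exists_mem_innerBoundary_of_isChain p hne
    (List.IsChain.imp (fun _ _ h => ⟨trivial, h⟩) hchain) hW (Or.inl hhead)

theorem MemGv.card_le {J W : Finset E} (h : D.MemGv Set.univ r v J) (hJW : J ⊆ W) :
    #J ≤ #(innerBoundary (D.Precedes Set.univ) {e | D.tail e = r} W) := by
  obtain ⟨hJ, Ps, hPs, hdisj, hcov⟩ := h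
  have hex : ∀ e, ∃ p f, e ∈ J → p ∈ Ps ∧ e ∈ p ∧ f ∈ p ∧
      f ∈ innerBoundary (D.Precedes Set.univ) {e | D.tail e = r} W := by
    intro e
    by_cases he : e ∈ J
    · obtain ⟨p, hp, hep⟩ := hcov e he
      obtain ⟨f, hfp, hf⟩ := (hPs p hp).exists_mem_innerBoundary (W := W)
        (by rw [(hPs p hp).eq_getLast hep (hJ he).2]; exact hJW he)
      exact ⟨p, f, fun _ => ⟨hp, hep, hfp, hf⟩⟩
    · exact ⟨[], e, fun h => absurd h he⟩
  choose p f hpf using hex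
  refine card_le_card_of_injOn f (fun e he => (hpf e he).2.2.2) fun e he e' he' hee => ?_
  obtain ⟨h1, h2, h3, -⟩ := hpf e he
  obtain ⟨h1', h2', h3', -⟩ := hpf e' he'
  have hpp : p e = p e' := by
    by_contra hne
    exact hdisj h1 h1' hne h3 (hee ▸ h3')
  rw [← (hPs _ h1).eq_getLast h2 (hJ he).2,
    ← (hPs _ h1).eq_getLast (hpp ▸ h2') (hJ he').2]

theorem exists_paths_of_isLinked {ht : V → ℕ} (hht : ∀ e, ht (D.tail e) < ht (D.head e))
    (hroot : ∀ e, D.head e ≠ r) {J : Finset E} (hJ : ∀ e ∈ J, e ∈ D.delta L v)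
    (h : IsLinked (D.Precedes L) {e | D.tail e = r} J) :
    ∃ P : E → List E, (∀ i ∈ J, D.IsPathIn L r v (P i) ∧ i ∈ P i) ∧
      ∀ i ∈ J, ∀ j ∈ J, i ≠ j → (P i).Disjoint (P j) := by
  obtain ⟨P, hP, hdisj⟩ := h.exists_chains (fun e => ht (D.head e))
    (fun e f hef => by rw [hef.2]; exact hht f)
  refine ⟨P, fun i hi => ?_, hdisj⟩
  obtain ⟨hne, hhead, hlast, hchain⟩ := hP i hi
  have hmem : i ∈ P i := by
    have := List.getLast_mem hne
    rwa [hlast] at this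
  refine ⟨⟨hne, hhead, by rw [hlast]; exact (hJ i hi).2, List.IsChain.imp (fun _ _ h => h.2) hchain,
    ?_, ?_⟩, hmem⟩
  · refine List.nodup_cons.2 ⟨?_, nodup_map_head hht (List.IsChain.imp (fun _ _ h => h.2) hchain)⟩
    simpa using fun e _ => hroot e
  · intro e he
    obtain ⟨k, hk, rfl⟩ := List.getElem_of_mem he
    by_cases hk1 : k + 1 < (P i).length
    · exact (List.isChain_iff_getElem.1 hchain k hk1).1
    · have : (P i)[k] = i := by
        refine Eq.trans ?_ hlast
        rw [List.getLast_eq_getElem]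
        congr 1
        omega
      rw [this]
      exact (hJ i hi).1

theorem memGv_of_isLinked {ht : V → ℕ} (hht : ∀ e, ht (D.tail e) < ht (D.head e))
    (hroot : ∀ e, D.head e ≠ r) {J : Finset E} (hJ : ∀ e ∈ J, e ∈ D.delta L v)
    (h : IsLinked (D.Precedes L) {e | D.tail e = r} J) : D.MemGv L r v J := by
  obtain ⟨P, hP, hdisj⟩ := exists_paths_of_isLinked hht hroot hJ h
  refine ⟨hJ, P '' J, ?_, ?_, fun i hi => ⟨P i, ⟨i, hi, rfl⟩, (hP i hi).2⟩⟩
  · rintro _ ⟨i, hi, rfl⟩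
    exact (hP i hi).1
  · rintro _ ⟨i, hi, rfl⟩ _ ⟨j, hj, rfl⟩ hne
    exact hdisj i hi j hj fun h => hne (by rw [h])

/-- Disjoint paths all meeting a cut with no more elements than there are paths have that cut
as a transversal. -/
theorem isTransversal_image {J C : Finset E} {P : E → List E} (hC : #C ≤ #J)
    (hdisj : ∀ i ∈ J, ∀ j ∈ J, i ≠ j → (P i).Disjoint (P j))
    (hmeet : ∀ i ∈ J, ∃ e ∈ P i, e ∈ C) : IsTransversal (P '' J) C := by
  choose! c hcP hcC using hmeet
  have hinj : Set.InjOn c J := fun i hi j hj hij => by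
    by_contra hne
    exact hdisj i hi j hj hne (hcP i hi) (hij ▸ hcP j hj)
  have hsurj : ∀ e ∈ C, ∃ i ∈ J, c i = e := by
    intro e he
    have := surjOn_of_injOn_of_card_le c hcC hinj hC he
    simpa using this
  refine ⟨?_, fun e he => ?_⟩
  · rintro _ ⟨i, hi, rfl⟩
    refine ⟨c i, ⟨hcC i hi, hcP i hi⟩, ?_⟩
    rintro e ⟨he, heP⟩
    obtain ⟨j, hj, rfl⟩ := hsurj e he
    by_contra hne
    exact hdisj i hi j hj (fun h => hne (by rw [h])) heP (hcP j hj)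
  · obtain ⟨i, hi, rfl⟩ := hsurj e he
    exact ⟨P i, ⟨i, hi, rfl⟩, hcP i hi⟩

variable [Fintype E]

/-- If adding `e` to a maximal `L` destroys membership in `𝒢(D)`, then a tight set witnesses
that `e` is spanned by the edges of `L` with the same head. -/
theorem exists_tight_of_notMem {ht : V → ℕ} (hht : ∀ e, ht (D.tail e) < ht (D.head e))
    (hroot : ∀ e, D.head e ≠ r) (hmem : D.MemG Set.univ r L)
    (hmax : ∀ L', D.MemG Set.univ r L' → L ⊆ L' → L' = L) {e : E} (he : e ∉ L) :
    ∃ W, e ∈ W ∧ (D.delta L (D.head e)).toFinset ⊆ W ∧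
      #(innerBoundary (D.Precedes Set.univ) {e | D.tail e = r} W) ≤
        #(D.delta L (D.head e)).toFinset := by
  set J := (D.delta L (D.head e)).toFinset with hJdef
  have heJ : e ∉ J := fun h => he (Set.mem_toFinset.1 h).1
  have hnot : ¬ IsLinked (D.Precedes Set.univ) {e | D.tail e = r} (insert e J) := by
    intro hl
    have hG := memGv_of_isLinked (v := D.head e) hht hroot (by
      intro f hf
      rcases mem_insert.1 hf with rfl | hf
      · exact ⟨trivial, rfl⟩
      · rw [hJdef, Set.mem_toFinset] at hf
        exact ⟨trivial, hf.2⟩) hl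
    refine he (hmax (insert e L) ⟨Set.subset_univ _, fun f _ => hroot f, fun u hu => ?_⟩
      (Set.subset_insert _ _) ▸ Set.mem_insert e L)
    by_cases hue : D.head e = u
    · subst hue
      convert hG using 1
      ext f
      simp only [delta, hJdef, coe_insert, Set.mem_insert_iff, Set.mem_ofPred_eq]
      grind
    · convert hmem.2.2 u hu using 1
      ext f
      simp only [delta, Set.mem_insert_iff, Set.mem_ofPred_eq]
      grind
  obtain ⟨W, hW, hWc⟩ := exists_card_innerBoundary_lt hnot
  rw [card_insert_of_notMem heJ] at hWc
  exact ⟨W, hW (mem_insert_self _ _), (subset_insert _ _).trans hW, by omega⟩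

/-- A tight hull of the edges of `L` entering `X` contains every edge with head in `X`. -/
theorem mem_tightHull_of_head_mem {ht : V → ℕ} (hht : ∀ e, ht (D.tail e) < ht (D.head e))
    (hroot : ∀ e, D.head e ≠ r) (hmem : D.MemG Set.univ r L)
    (hmax : ∀ L', D.MemG Set.univ r L' → L ⊆ L' → L' = L) {X : Set V} (hrX : r ∉ X)
    {Y : Finset E} (hY : IsTightHull (D.Precedes Set.univ) {e | D.tail e = r}
      (D.edgesInto L X).toFinset Y) {e : E} (he : D.head e ∈ X) : e ∈ Y := by
  induction hn : ht (D.head e) using Nat.strong_induction_on generalizing e with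
  | _ n ih =>
    have hL : ∀ f ∈ L, D.head f = D.head e → f ∈ Y := by
      intro f hf hfe
      by_cases hfX : D.tail f ∈ X
      · refine hY.mem_of_forall_pred (fun h => hrX (h ▸ hfX)) fun a ha => ?_
        have hlt := hht f
        exact ih (ht (D.head a)) (by rw [ha.2, ← hn, ← hfe]; exact hlt) (by rwa [ha.2]) rfl
      · exact hY.1 (by simpa using ⟨hf, hfX, by rwa [hfe]⟩)
    by_cases heL : e ∈ L
    · exact hL e heL rfl
    obtain ⟨W, heW, hJW, hWc⟩ := exists_tight_of_notMem hht hroot hmem hmax heL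
    refine hY.subset_of_card_le (fun Z hZ => ?_) (fun f hf => ?_) hJW hWc heW
    · exact MemGv.card_le (by simpa using hmem.2.2 _ (hroot e)) hZ
    · rw [Set.mem_toFinset] at hf
      exact hL f hf.1 hf.2

end Paths

end MultiDigraph

/-- **Szeszlér.** In a finite acyclic `r`-rooted digraph, every
maximal element of `𝒢(D)` is large. -/
theorem stmt18 {V E : Type*} [Fintype V] [Fintype E] (D : MultiDigraph V E) (r : V)
    (hroot : ∀ e, D.head e ≠ r)
    (hacyclic : ¬ D.HasCycle)
    (L : Set E)
    (hmem : D.MemG Set.univ r L)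
    (hmax : ∀ L', D.MemG Set.univ r L' → L ⊆ L' → L' = L) :
    D.Large r L := by
  classical
  intro v hv
  obtain ⟨ht, hht⟩ := MultiDigraph.exists_height hacyclic
  obtain ⟨I, Z, hI, hlink, hZ, hZc⟩ := exists_isLinked_subset (R := D.Precedes L)
    (A := {e | D.tail e = r}) (D.delta L v).toFinset
  let X : Set V := {u | u ≠ r ∧ ∀ f ∈ L, D.head f = u → f ∈ Z}
  have hvX : v ∈ X := ⟨hv, fun f hf hfv => hZ (by simpa using ⟨hf, hfv⟩)⟩
  have hXZ : (D.edgesInto L X).toFinset ⊆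
      innerBoundary (D.Precedes L) {e | D.tail e = r} Z := by
    intro e he
    rw [Set.mem_toFinset] at he
    refine mem_innerBoundary.2 ⟨he.2.2.2 e he.1 rfl, ?_⟩
    by_contra! hcon
    exact he.2.1 ⟨hcon.1, fun f hf hfe => hcon.2 f ⟨hf, hfe⟩⟩
  obtain ⟨Y, hY⟩ := exists_isTightHull (R := D.Precedes Set.univ) (A := {e | D.tail e = r})
    (D.edgesInto L X).toFinset
  have hYc := hY.card_le.trans ((Finset.card_le_card hXZ).trans hZc)
  have hcut : D.IsCut Set.univ r v
      (innerBoundary (D.Precedes Set.univ) {e | D.tail e = r} Y : Finset E) := by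
    intro p hp
    refine hp.exists_mem_innerBoundary
      (MultiDigraph.mem_tightHull_of_head_mem hht hroot hmem hmax (fun h => h.1 rfl) hY ?_)
    rwa [hp.2.2.1]
  obtain ⟨P, hP, hdisj⟩ := MultiDigraph.exists_paths_of_isLinked hht hroot
    (fun e he => by simpa using hI he) hlink
  refine ⟨P '' I, _, ?_, ?_, MultiDigraph.isTransversal_image hYc hdisj fun i hi => ?_, hcut⟩
  · rintro _ ⟨i, hi, rfl⟩
    exact (hP i hi).1
  · rintro _ ⟨i, hi, rfl⟩ _ ⟨j, hj, rfl⟩ hne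
    exact hdisj i hi j hj fun h => hne (by rw [h])
  · obtain ⟨hne, h1, h2, h3, h4, -⟩ := (hP i hi).1
    exact hcut _ ⟨hne, h1, h2, h3, h4, fun _ _ => trivial⟩
end
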